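/- Suppose x₀ > 0 and x₁ > 0. Then liminf_{n→∞} (E(n))^{1/n} ≥ 1.1209, where E(n) = S(n)/2ⁿ is the expected absolute value of the n-th term of a random Fibonacci sequence with equiprobable independent signs. (This is the lower half of the paper's Theorem 1, which asserts the bound 1.12095.) -/

import Mathlib

open Filter

/-- The random Fibonacci sequence determined by initial values `x0, x1` and the
sign sequence `ε : Fin n → Bool` (`true` ↦ `+1`, `false` ↦ `-1`):
`x 0 = x0`, `x 1 = x1`, `x (k+2) = (±1) * x (k+1) + x k` where the sign is `ε k`. -/
noncomputable def randFib (x0 x1 : ℝ) {n : ℕ} (ε : Fin n → Bool) : ℕ → ℝ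
  | 0 => x0
  | 1 => x1
  | k + 2 =>
      (if h : k < n then (if ε ⟨k, h⟩ then (1 : ℝ) else -1) else 1) *
        randFib x0 x1 ε (k + 1) + randFib x0 x1 ε k

/-- `rowSum x0 x1 n` is the sum of the absolute values of the `n`-th row of the tree
of all `2^n` random Fibonacci sequences with initial values `x0, x1`. -/
noncomputable def rowSum (x0 x1 : ℝ) (n : ℕ) : ℝ :=
  ∑ ε : Fin n → Bool, |randFib x0 x1 ε (n + 1)|

/-- `expAbs x0 x1 n = rowSum x0 x1 n / 2 ^ n` is the expected absolute value of the
`n`-th term of a random Fibonacci sequence with equiprobable independent signs. -/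
noncomputable def expAbs (x0 x1 : ℝ) (n : ℕ) : ℝ := rowSum x0 x1 n / 2 ^ n

theorem randFib_cons (x0 x1 : ℝ) {n : ℕ} (s : Bool) (ε : Fin n → Bool) :
    ∀ k : ℕ, randFib x0 x1 (Fin.cons s ε : Fin (n + 1) → Bool) (k + 1) =
      randFib x1 ((if s then 1 else -1) * x1 + x0) ε k
  | 0 => by simp [randFib]
  | 1 => by simp [randFib]
  | k + 2 => by
    rw [randFib, randFib_cons x0 x1 s ε (k + 1), randFib_cons x0 x1 s ε k, randFib]
    congr 2
    by_cases h : k < n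
    · have h' : k + 1 < n + 1 := by omega
      rw [dif_pos h, dif_pos h',
        show (⟨k + 1, h'⟩ : Fin (n + 1)) = Fin.succ ⟨k, h⟩ from rfl, Fin.cons_succ]
    · rw [dif_neg h, dif_neg (by omega)]

theorem rowSum_zero (x0 x1 : ℝ) : rowSum x0 x1 0 = |x1| := by
  simp [rowSum, randFib]

theorem rowSum_succ (x0 x1 : ℝ) (n : ℕ) :
    rowSum x0 x1 (n + 1) = rowSum x1 (x1 + x0) n + rowSum x1 (-x1 + x0) n := by
  unfold rowSum
  rw [← (Fin.consEquiv fun _ : Fin (n + 1) => Bool).sum_comp, Fintype.sum_prod_type]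
  have h (s : Bool) (ε : Fin n → Bool) :
      randFib x0 x1 (Fin.consEquiv (fun _ : Fin (n + 1) => Bool) (s, ε)) (n + 1 + 1) =
        randFib x1 ((if s then 1 else -1) * x1 + x0) ε (n + 1) :=
    randFib_cons x0 x1 s ε (n + 1)
  simp [h]

/-- Over three generations, the row sum grows by a factor of at least `12`. -/
theorem twelve_mul_rowSum_le (n : ℕ) :
    ∀ x0 x1 : ℝ, 12 * rowSum x0 x1 n ≤ rowSum x0 x1 (n + 3) := by
  induction n with
  | zero =>
    intro a b
    simp only [rowSum_succ, rowSum_zero]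
    ring_nf
    grind
  | succ n ih =>
    intro a b
    rw [rowSum_succ a b n, show n + 1 + 3 = (n + 3) + 1 by ring, rowSum_succ a b (n + 3)]
    linarith [ih b (b + a), ih b (-b + a)]

theorem rowSum_le (n : ℕ) : ∀ x0 x1 : ℝ, rowSum x0 x1 n ≤ 4 ^ n * (|x0| + |x1|) := by
  induction n with
  | zero => intro a b; simp [rowSum_zero]
  | succ n ih =>
    intro a b
    have h4 : (0 : ℝ) < 4 ^ n := by positivity
    have h : |b| + |b + a| + (|b| + |-b + a|) ≤ 4 * (|a| + |b|) := by grind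
    rw [rowSum_succ, pow_succ]
    nlinarith [ih b (b + a), ih b (-b + a)]

theorem exists_mul_pow_le_rowSum {x0 x1 : ℝ} (hx0 : 0 < x0) (hx1 : 0 < x1) :
    ∃ c : ℝ, 0 < c ∧ ∀ n : ℕ, c * 2.28 ^ n ≤ rowSum x0 x1 n := by
  have h0 : x1 ≤ rowSum x0 x1 0 := by
    rw [rowSum_zero]
    exact le_abs_self x1
  have h1 : x1 ≤ rowSum x0 x1 1 := by
    simp only [rowSum_succ, rowSum_zero]
    grind
  have h2 : x1 ≤ rowSum x0 x1 2 := by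
    simp only [rowSum_succ, rowSum_zero]
    grind
  refine ⟨x1 / 6, by positivity, fun n => ?_⟩
  induction n using Nat.strong_induction_on with
  | _ n ih =>
    match n with
    | 0 => norm_num; linarith
    | 1 => norm_num; linarith
    | 2 => norm_num; linarith
    | n + 3 =>
      have h := ih n (by omega)
      have hp : 0 < x1 / 6 * 2.28 ^ n := by positivity
      calc x1 / 6 * 2.28 ^ (n + 3) = x1 / 6 * 2.28 ^ n * 2.28 ^ 3 := by ring
        _ ≤ x1 / 6 * 2.28 ^ n * 12 := by gcongr; norm_num
        _ ≤ 12 * rowSum x0 x1 n := by linarith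
        _ ≤ rowSum x0 x1 (n + 3) := twelve_mul_rowSum_le n x0 x1

theorem expAbs_nonneg (x0 x1 : ℝ) (n : ℕ) : 0 ≤ expAbs x0 x1 n :=
  div_nonneg (Finset.sum_nonneg fun _ _ => abs_nonneg _) (by positivity)

theorem expAbs_le (x0 x1 : ℝ) (n : ℕ) : expAbs x0 x1 n ≤ 2 ^ n * (|x0| + |x1|) := by
  rw [expAbs, div_le_iff₀ (by positivity)]
  calc rowSum x0 x1 n ≤ 4 ^ n * (|x0| + |x1|) := rowSum_le n x0 x1
    _ = 2 ^ n * (|x0| + |x1|) * 2 ^ n := by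
      rw [show (4 : ℝ) = 2 * 2 by norm_num, mul_pow]
      ring

theorem expAbs_liminf_lower (x0 x1 : ℝ) (hx0 : 0 < x0) (hx1 : 0 < x1) :
    (1.1209 : ℝ) ≤ liminf (fun n : ℕ => expAbs x0 x1 n ^ ((n : ℝ)⁻¹)) atTop := by
  refine le_liminf_of_le (IsBoundedUnder.isCoboundedUnder_ge ?_) ?_
  · refine isBoundedUnder_of_eventually_le (a := 2 * (|x0| + |x1| + 1)) ?_
    filter_upwards [eventually_ne_atTop 0] with n hn
    have hK : (0 : ℝ) ≤ 2 * (|x0| + |x1| + 1) := by positivity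
    have h1 : 1 ≤ |x0| + |x1| + 1 := by
      linarith [abs_nonneg x0, abs_nonneg x1]
    rw [← Real.pow_rpow_inv_natCast hK hn]
    refine Real.rpow_le_rpow (expAbs_nonneg x0 x1 n) ?_ (by positivity)
    rw [mul_pow]
    refine (expAbs_le x0 x1 n).trans ?_
    gcongr
    linarith [le_self_pow₀ h1 hn]
  · obtain ⟨c, hc, hle⟩ := exists_mul_pow_le_rowSum hx0 hx1
    have ht : Tendsto (fun n : ℕ => (1.14 / 1.1209 : ℝ) ^ n) atTop atTop :=
      tendsto_pow_atTop_atTop_of_one_lt (by norm_num)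
    filter_upwards [ht.eventually_ge_atTop c⁻¹, eventually_ne_atTop 0] with n hn hn0
    rw [← Real.pow_rpow_inv_natCast (show (0 : ℝ) ≤ 1.1209 by norm_num) hn0]
    refine Real.rpow_le_rpow (by positivity) ?_ (by positivity)
    rw [div_pow, le_div_iff₀ (by positivity), inv_mul_le_iff₀ hc] at hn
    refine hn.trans ?_
    rw [expAbs, le_div_iff₀ (by positivity), mul_assoc, ← mul_pow]
    norm_num at hle ⊢
    exact hle n
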